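/- There is an absolute constant M₀>0 such that for all 0<M≤M₀ the following holds. Define x̃⁰=t and x̃^i=x^i+Mω^iχ(r/(t+1))ln r, let A^a_α=∂x̃^a/∂x^α, and let A^α_a be the inverse matrix (which exists for M≤M₀). Then for every multiindex β there is a constant C_β, independent of M, t, x, such that for all t≥0 and x≠0: |∂^β(A^a_α−δ^a_α)| + |∂^β(A^α_a−δ^α_a)| ≤ C_β M ⟨ln r⟩ r^{−1−|β|}; moreover A^a_α−δ^a_α and A^α_a−δ^α_a vanish identically on the region r/(t+1)≤1/4. -/

import Mathlib

noncomputable section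
open MeasureTheory

abbrev E3 : Type := EuclideanSpace ℝ (Fin 3)
abbrev Spt : Type := ℝ × E3

/-- The coordinate basis directions of `ℝ^{1+3}`. -/
def dir (a : Fin 4) : Spt :=
  Fin.cases ((1:ℝ), (0:E3)) (fun i => ((0:ℝ), EuclideanSpace.single i (1:ℝ))) a

/-- Coordinate partial derivative `∂_a`. -/
def pd (a : Fin 4) (f : Spt → ℝ) (p : Spt) : ℝ := fderiv ℝ f p (dir a)

def toVec (c : Fin 4 → ℝ) : Spt := ∑ a : Fin 4, c a • dir a

/-- The japanese bracket `⟨s⟩ = 1 + |s|`. -/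
def jap (s : ℝ) : ℝ := 1 + |s|

/-- ω = x/|x| -/
def omg (p : Spt) : E3 := ‖p.2‖⁻¹ • p.2

def Ldir (p : Spt) : Spt := ((1:ℝ), omg p)
def Lbardir (p : Spt) : Spt := ((1:ℝ), -omg p)
def qdir (p : Spt) : Spt := (-(1:ℝ)/2, (2⁻¹:ℝ) • omg p)
def angDir (i : Fin 3) (p : Spt) : Spt :=
  ((0:ℝ), EuclideanSpace.single i (1:ℝ) - omg p i • omg p)

/-- The Minkowski metric (= its inverse) `diag(-1,1,1,1)`. -/
def eta (a b : Fin 4) : ℝ := if a = b then (if a = 0 then -1 else 1) else 0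

def Llow (p : Spt) (a : Fin 4) : ℝ := Fin.cases (-1:ℝ) (fun i => omg p i) a
def Lup (p : Spt) (a : Fin 4) : ℝ := Fin.cases (1:ℝ) (fun i => omg p i) a
def Lbarlow (p : Spt) (a : Fin 4) : ℝ := Fin.cases (-1:ℝ) (fun i => -omg p i) a
def Lbarup (p : Spt) (a : Fin 4) : ℝ := Fin.cases (1:ℝ) (fun i => -omg p i) a

/-- Index type for the Minkowski commuting vector fields: translations,
rotations/boosts, scaling. -/
abbrev ZIdx : Type := Fin 4 ⊕ (Fin 4 × Fin 4) ⊕ Unit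

def xlow (p : Spt) (a : Fin 4) : ℝ := Fin.cases (-p.1) (fun i => p.2 i) a
def xup (p : Spt) (a : Fin 4) : ℝ := Fin.cases p.1 (fun i => p.2 i) a

/-- The components of the Minkowski commuting vector fields. -/
def zfield : ZIdx → Spt → Fin 4 → ℝ
  | Sum.inl a => fun _ c => if c = a then 1 else 0
  | Sum.inr (Sum.inl ab) => fun p c =>
      xlow p ab.1 * (if c = ab.2 then 1 else 0) - xlow p ab.2 * (if c = ab.1 then 1 else 0)
  | Sum.inr (Sum.inr _) => fun p => xup p

/-- `Z^I` applied to a scalar function. -/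
def zApply : {k : ℕ} → (Fin k → ZIdx) → (Spt → ℝ) → Spt → ℝ
  | 0, _, f => f
  | _+1, I, f => fun p => fderiv ℝ (zApply (fun j => I j.succ) f) p (toVec (zfield (I 0) p))

/-- `∂^β` applied to a scalar function. -/
def pdT : {k : ℕ} → (Fin k → Fin 4) → (Spt → ℝ) → Spt → ℝ
  | 0, _, f => f
  | _+1, β, f => pd (β 0) (pdT (fun j => β j.succ) f)

def pdd (a b : Fin 4) (f : Spt → ℝ) : Spt → ℝ := pd a (pd b f)

/-- The flat wave operator `□ = -∂_t² + Δ`. -/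
def box (f : Spt → ℝ) (p : Spt) : ℝ := -(pdd 0 0 f p) + ∑ i : Fin 3, pdd i.succ i.succ f p


/-- Kronecker delta. -/
def kron (a b : Fin 4) : ℝ := if a = b then 1 else 0

/-- The asymptotically Schwarzschild coordinates `x̃⁰ = t`,
`x̃^i = x^i + M ω^i χ(r/(t+1)) ln r`. -/
def xt (M : ℝ) (χ : ℝ → ℝ) (a : Fin 4) : Spt → ℝ :=
  Fin.cases (fun p : Spt => p.1)
    (fun i => fun p : Spt =>
      p.2 i + M * (p.2 i / ‖p.2‖) * χ (‖p.2‖ / (p.1 + 1)) * Real.log ‖p.2‖) a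

/-- The Jacobian `A^a_α = ∂x̃^a/∂x^α`. -/
def Amat (M : ℝ) (χ : ℝ → ℝ) (p : Spt) : Matrix (Fin 4) (Fin 4) ℝ :=
  Matrix.of fun a α => pd α (xt M χ a) p

/-- The inverse Jacobian `A^α_a`. -/
def Ainv (M : ℝ) (χ : ℝ → ℝ) (p : Spt) : Matrix (Fin 4) (Fin 4) ℝ := (Amat M χ p)⁻¹

open scoped ContDiff

/-- The open region on which everything is estimated. -/
def UU : Set Spt := {p | -(1/2:ℝ) < p.1 ∧ p.2 ≠ 0}

lemma UU_open : IsOpen UU := by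
  have h1 : IsOpen {p : Spt | -(1/2:ℝ) < p.1} := isOpen_lt continuous_const continuous_fst
  have h2 : IsOpen {p : Spt | p.2 ≠ 0} := isOpen_ne_fun continuous_snd continuous_const
  exact h1.inter h2

/-- Symbol type estimates up to order `n`. -/
def Sy (M₀ : ℝ) : ℕ → (ℝ → Spt → ℝ) → (ℝ → Spt → ℝ) → Prop
  | 0, w, f => (∀ M, 0 < M → M ≤ M₀ → ContDiffOn ℝ ∞ (f M) UU) ∧
      ∃ C : ℝ, 0 < C ∧ ∀ M, 0 < M → M ≤ M₀ → ∀ p ∈ UU, |f M p| ≤ C * w M p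
  | n+1, w, f => ((∀ M, 0 < M → M ≤ M₀ → ContDiffOn ℝ ∞ (f M) UU) ∧
      ∃ C : ℝ, 0 < C ∧ ∀ M, 0 < M → M ≤ M₀ → ∀ p ∈ UU, |f M p| ≤ C * w M p) ∧
      ∀ a, Sy M₀ n (fun M p => w M p * ‖p.2‖⁻¹) (fun M => pd a (f M))

lemma Sy.zero {M₀ : ℝ} {n : ℕ} {w f : ℝ → Spt → ℝ} (h : Sy M₀ n w f) : Sy M₀ 0 w f := by
  cases n with
  | zero => exact h
  | succ n => exact h.1

lemma Sy.smooth {M₀ : ℝ} {n : ℕ} {w f : ℝ → Spt → ℝ} (h : Sy M₀ n w f) :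
    ∀ M, 0 < M → M ≤ M₀ → ContDiffOn ℝ ∞ (f M) UU := h.zero.1

lemma pd_contDiffOn {f : Spt → ℝ} (h : ContDiffOn ℝ ∞ f UU) (a : Fin 4) :
    ContDiffOn ℝ ∞ (pd a f) UU := by
  have h1 : ContDiffOn ℝ ∞ (fderiv ℝ f) UU := h.fderiv_of_isOpen UU_open (by simp)
  exact h1.clm_apply contDiffOn_const

lemma smooth_diffAt {f : Spt → ℝ} (h : ContDiffOn ℝ ∞ f UU) {p : Spt} (hp : p ∈ UU) :
    DifferentiableAt ℝ f p :=
  (h.differentiableOn (by simp)).differentiableAt (UU_open.mem_nhds hp)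

lemma pd_congr {f g : Spt → ℝ} (h : ∀ p ∈ UU, f p = g p) (a : Fin 4) :
    ∀ p ∈ UU, pd a f p = pd a g p := by
  intro p hp
  have : f =ᶠ[nhds p] g := Filter.eventually_of_mem (UU_open.mem_nhds hp) h
  simp only [pd, this.fderiv_eq]

lemma pd_add {f g : Spt → ℝ} {p : Spt} (hf : DifferentiableAt ℝ f p) (hg : DifferentiableAt ℝ g p)
    (a : Fin 4) : pd a (fun p => f p + g p) p = pd a f p + pd a g p := by
  simp only [pd]
  rw [fderiv_fun_add hf hg]; rfl

lemma pd_mul {f g : Spt → ℝ} {p : Spt} (hf : DifferentiableAt ℝ f p) (hg : DifferentiableAt ℝ g p)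
    (a : Fin 4) : pd a (fun p => f p * g p) p = f p * pd a g p + pd a f p * g p := by
  simp only [pd]
  rw [fderiv_fun_mul hf hg]; simp; ring

lemma pd_sum {ι : Type} (s : Finset ι) {f : ι → Spt → ℝ} {p : Spt}
    (hf : ∀ i ∈ s, DifferentiableAt ℝ (f i) p)
    (a : Fin 4) : pd a (fun p => ∑ i ∈ s, f i p) p = ∑ i ∈ s, pd a (f i) p := by
  simp only [pd]
  rw [fderiv_fun_sum hf]; simp

lemma pd_const (c : ℝ) (a : Fin 4) (p : Spt) : pd a (fun _ => c) p = 0 := by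
  simp [pd]

lemma pd_comp {φ : ℝ → ℝ} {g : Spt → ℝ} {p : Spt} (hφ : DifferentiableAt ℝ φ (g p))
    (hg : DifferentiableAt ℝ g p)
    (a : Fin 4) : pd a (fun p => φ (g p)) p = deriv φ (g p) * pd a g p := by
  have h : HasFDerivAt (fun p => φ (g p)) (deriv φ (g p) • fderiv ℝ g p) p :=
    hφ.hasDerivAt.comp_hasFDerivAt p hg.hasFDerivAt
  simp [pd, h.fderiv]

lemma Sy.congr {M₀ : ℝ} {n : ℕ} : ∀ {w f g : ℝ → Spt → ℝ}, Sy M₀ n w f →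
    (∀ M, 0 < M → M ≤ M₀ → ∀ p ∈ UU, g M p = f M p) → Sy M₀ n w g := by
  have key : ∀ {w f g : ℝ → Spt → ℝ}, Sy M₀ 0 w f →
    (∀ M, 0 < M → M ≤ M₀ → ∀ p ∈ UU, g M p = f M p) → Sy M₀ 0 w g := by
    intro w f g ⟨h1, C, hC, h2⟩ h
    refine ⟨fun M hM hM' => (h1 M hM hM').congr (h M hM hM'), C, hC, fun M hM hM' p hp => ?_⟩
    rw [h M hM hM' p hp]; exact h2 M hM hM' p hp
  induction n with
  | zero => exact key
  | succ n ih =>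
    intro w f g hf h
    exact ⟨key hf.1 h, fun a => ih (hf.2 a) fun M hM hM' => pd_congr (h M hM hM') a⟩

lemma Sy.mono {M₀ : ℝ} {n : ℕ} (K : ℝ) (hK : 0 < K) : ∀ {w v f : ℝ → Spt → ℝ}, Sy M₀ n w f →
    (∀ M, 0 < M → M ≤ M₀ → ∀ p ∈ UU, w M p ≤ K * v M p) → Sy M₀ n v f := by
  have key : ∀ {w v f : ℝ → Spt → ℝ}, Sy M₀ 0 w f →
    (∀ M, 0 < M → M ≤ M₀ → ∀ p ∈ UU, w M p ≤ K * v M p) → Sy M₀ 0 v f := by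
    intro w v f ⟨h1, C, hC, h2⟩ h
    refine ⟨h1, C * K, by positivity, fun M hM hM' p hp => (h2 M hM hM' p hp).trans ?_⟩
    rw [mul_assoc]
    exact mul_le_mul_of_nonneg_left (h M hM hM' p hp) hC.le
  induction n with
  | zero => exact key
  | succ n ih =>
    intro w v f hf h
    refine ⟨key hf.1 h, fun a => ih (hf.2 a) fun M hM hM' p hp => ?_⟩
    rw [← mul_assoc]
    exact mul_le_mul_of_nonneg_right (h M hM hM' p hp) (by positivity)

lemma Sy.mono' {M₀ : ℝ} {n : ℕ} {w v f : ℝ → Spt → ℝ} (hf : Sy M₀ n w f)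
    (h : ∀ M, 0 < M → M ≤ M₀ → ∀ p ∈ UU, w M p ≤ v M p) : Sy M₀ n v f :=
  hf.mono 1 one_pos (by simpa using h)

lemma Sy.pred {M₀ : ℝ} {n : ℕ} : ∀ {w f : ℝ → Spt → ℝ}, Sy M₀ (n+1) w f → Sy M₀ n w f := by
  induction n with
  | zero => intro w f h; exact h.1
  | succ n ih => intro w f h; exact ⟨h.1, fun a => ih (h.2 a)⟩

lemma Sy.add {M₀ : ℝ} {n : ℕ} : ∀ {w f g : ℝ → Spt → ℝ}, Sy M₀ n w f → Sy M₀ n w g →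
    Sy M₀ n w (fun M p => f M p + g M p) := by
  have key : ∀ {w f g : ℝ → Spt → ℝ}, Sy M₀ 0 w f → Sy M₀ 0 w g →
    Sy M₀ 0 w (fun M p => f M p + g M p) := by
    intro w f g ⟨h1, C, hC, h2⟩ ⟨h1', C', hC', h2'⟩
    refine ⟨fun M hM hM' => (h1 M hM hM').add (h1' M hM hM'), C + C', by positivity,
      fun M hM hM' p hp => (abs_add_le _ _).trans ?_⟩
    rw [add_mul]; exact add_le_add (h2 M hM hM' p hp) (h2' M hM hM' p hp)
  induction n with
  | zero => exact key
  | succ n ih =>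
    intro w f g hf hg
    refine ⟨key hf.1 hg.1, fun a => (ih (hf.2 a) (hg.2 a)).congr fun M hM hM' p hp => ?_⟩
    exact pd_add (smooth_diffAt (hf.smooth M hM hM') hp) (smooth_diffAt (hg.smooth M hM hM') hp) a

lemma Sy.mul {M₀ : ℝ} {n : ℕ} : ∀ {w v f g : ℝ → Spt → ℝ}, Sy M₀ n w f → Sy M₀ n v g →
    Sy M₀ n (fun M p => w M p * v M p) (fun M p => f M p * g M p) := by
  have key : ∀ {w v f g : ℝ → Spt → ℝ}, Sy M₀ 0 w f → Sy M₀ 0 v g →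
    Sy M₀ 0 (fun M p => w M p * v M p) (fun M p => f M p * g M p) := by
    intro w v f g ⟨h1, C, hC, h2⟩ ⟨h1', C', hC', h2'⟩
    refine ⟨fun M hM hM' => (h1 M hM hM').mul (h1' M hM hM'), C * C', by positivity,
      fun M hM hM' p hp => ?_⟩
    rw [abs_mul, mul_mul_mul_comm]
    exact mul_le_mul (h2 M hM hM' p hp) (h2' M hM hM' p hp) (abs_nonneg _)
      ((abs_nonneg _).trans (h2 M hM hM' p hp))
  induction n with
  | zero => exact key
  | succ n ih =>
    intro w v f g hf hg
    refine ⟨key hf.1 hg.1, fun a => ?_⟩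
    have e1 := ih hf.pred (hg.2 a)
    have e2 := ih (hf.2 a) hg.pred
    have e1' := e1.mono' (v := fun M p => w M p * v M p * ‖p.2‖⁻¹)
      (fun M _ _ p _ => le_of_eq (by ring))
    have e2' := e2.mono' (v := fun M p => w M p * v M p * ‖p.2‖⁻¹)
      (fun M _ _ p _ => le_of_eq (by ring))
    refine (e1'.add e2').congr fun M hM hM' p hp => ?_
    exact pd_mul (smooth_diffAt (hf.smooth M hM hM') hp) (smooth_diffAt (hg.smooth M hM hM') hp) a

lemma Sy.czero {M₀ : ℝ} {n : ℕ} : ∀ {w : ℝ → Spt → ℝ},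
    (∀ M, 0 < M → M ≤ M₀ → ∀ p ∈ UU, 0 ≤ w M p) → Sy M₀ n w (fun _ _ => 0) := by
  have key : ∀ {w : ℝ → Spt → ℝ},
    (∀ M, 0 < M → M ≤ M₀ → ∀ p ∈ UU, 0 ≤ w M p) → Sy M₀ 0 w (fun _ _ => 0) := by
    intro w hw
    exact ⟨fun M _ _ => contDiffOn_const, 1, one_pos, by simpa using hw⟩
  induction n with
  | zero => exact key
  | succ n ih =>
    intro w hw
    refine ⟨key hw, fun a => (ih fun M hM hM' p hp => ?_).congr fun M _ _ p _ => pd_const 0 a p⟩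
    have := hw M hM hM' p hp
    positivity

lemma Sy.const {M₀ : ℝ} {n : ℕ} (c : ℝ) : Sy M₀ n (fun _ _ => 1) (fun _ _ => c) := by
  have key : Sy M₀ 0 (fun _ _ => 1) (fun _ _ => c) :=
    ⟨fun M _ _ => contDiffOn_const, |c| + 1, by positivity, fun M _ _ p _ => by simp⟩
  cases n with
  | zero => exact key
  | succ n =>
    refine ⟨key, fun a => (Sy.czero fun M hM hM' p hp => ?_).congr fun M _ _ p _ => pd_const c a p⟩
    positivity

lemma Sy.cMul {M₀ : ℝ} {n : ℕ} {w f : ℝ → Spt → ℝ} (c : ℝ) (h : Sy M₀ n w f) :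
    Sy M₀ n w (fun M p => c * f M p) :=
  ((Sy.const c).mul h).mono' (fun M _ _ p _ => by simp)

lemma Sy.mMul {M₀ : ℝ} {n : ℕ} : ∀ {w f : ℝ → Spt → ℝ}, Sy M₀ n w f →
    Sy M₀ n (fun M p => M * w M p) (fun M p => M * f M p) := by
  have key : ∀ {w f : ℝ → Spt → ℝ}, Sy M₀ 0 w f →
    Sy M₀ 0 (fun M p => M * w M p) (fun M p => M * f M p) := by
    intro w f ⟨h1, C, hC, h2⟩
    refine ⟨fun M hM hM' => contDiffOn_const.mul (h1 M hM hM'), C, hC, fun M hM hM' p hp => ?_⟩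
    rw [abs_mul, abs_of_pos hM]
    nlinarith [h2 M hM hM' p hp]
  induction n with
  | zero => exact key
  | succ n ih =>
    intro w f hf
    refine ⟨key hf.1, fun a => ((ih (hf.2 a)).mono' fun M _ _ p _ => ?_).congr
      fun M hM hM' p hp => ?_⟩
    · exact le_of_eq (by ring)
    · rw [pd_mul (differentiableAt_const M) (smooth_diffAt (hf.smooth M hM hM') hp) a, pd_const]
      ring

lemma Sy.sum {M₀ : ℝ} {n : ℕ} {w : ℝ → Spt → ℝ} {ι : Type} (s : Finset ι) {f : ι → ℝ → Spt → ℝ}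
    (hw : ∀ M, 0 < M → M ≤ M₀ → ∀ p ∈ UU, 0 ≤ w M p)
    (h : ∀ i, Sy M₀ n w (f i)) : Sy M₀ n w (fun M p => ∑ i ∈ s, f i M p) := by
  classical
  induction s using Finset.induction_on with
  | empty => simpa using Sy.czero hw
  | insert a s ha ih => simpa [Finset.sum_insert ha] using (h a).add ih

lemma pdT_last {j : ℕ} : ∀ (β : Fin (j+1) → Fin 4) (f : Spt → ℝ),
    pdT β f = pdT (fun i : Fin j => β i.castSucc) (pd (β (Fin.last j)) f) := by
  induction j with
  | zero => intro β f; rfl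
  | succ j ih =>
    intro β f
    show pd (β 0) (pdT (fun j => β j.succ) f) = _
    rw [ih]; rfl

lemma Sy.pdT_bound {M₀ : ℝ} {j : ℕ} : ∀ {w f : ℝ → Spt → ℝ}, Sy M₀ j w f → ∀ (β : Fin j → Fin 4),
    ∃ C : ℝ, 0 < C ∧ ∀ M, 0 < M → M ≤ M₀ → ∀ p ∈ UU,
      |pdT β (f M) p| ≤ C * (w M p * (‖p.2‖⁻¹) ^ j) := by
  induction j with
  | zero =>
    intro w f h β
    obtain ⟨-, C, hC, h⟩ := h
    exact ⟨C, hC, fun M hM hM' p hp => by simpa [pdT] using h M hM hM' p hp⟩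
  | succ j ih =>
    intro w f h β
    obtain ⟨C, hC, h⟩ := ih (h.2 (β (Fin.last j))) (fun i => β i.castSucc)
    refine ⟨C, hC, fun M hM hM' p hp => ?_⟩
    rw [pdT_last]
    refine (h M hM hM' p hp).trans (le_of_eq ?_)
    ring

def omm (a : Fin 4) (p : Spt) : ℝ := Fin.cases (0:ℝ) (fun i => p.2 i / ‖p.2‖) a

def cc (a b : Fin 4) : ℝ := if a = b then (if a = 0 then 0 else 1) else 0

def xs (a : Fin 4) (p : Spt) : ℝ := Fin.cases (0:ℝ) (fun i => p.2 i) a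

lemma xs_contDiff (a : Fin 4) : ContDiff ℝ ∞ (xs a) := by
  refine Fin.cases ?_ (fun i => ?_) a
  · exact contDiff_const
  · show ContDiff ℝ ∞ (fun p : Spt => p.2 i)
    fun_prop

lemma pd_xs (a b : Fin 4) (p : Spt) : pd b (xs a) p = cc a b := by
  induction a using Fin.cases with
  | zero =>
    have : xs 0 = fun _ => 0 := rfl
    rw [this, pd_const]; simp [cc]
  | succ i =>
    have h : xs i.succ = fun p => (EuclideanSpace.proj i ∘L ContinuousLinearMap.snd ℝ ℝ E3) p := rfl
    rw [h, pd, ContinuousLinearMap.fderiv]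
    induction b using Fin.cases with
    | zero => simp [dir, cc]
    | succ k => simp [dir, cc, Fin.succ_ne_zero]

lemma r_pos {p : Spt} (hp : p ∈ UU) : 0 < ‖p.2‖ := norm_pos_iff.2 hp.2

lemma r_smooth : ContDiffOn ℝ ∞ (fun p : Spt => ‖p.2‖) UU := by
  intro p hp
  exact (contDiff_snd.contDiffAt.norm ℝ hp.2).contDiffWithinAt

lemma omm_eq (a : Fin 4) (p : Spt) : omm a p = xs a p * ‖p.2‖⁻¹ := by
  refine Fin.cases ?_ (fun i => ?_) a <;> simp [omm, xs, div_eq_mul_inv]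

lemma pd_r (a : Fin 4) {p : Spt} (hp : p ∈ UU) : pd a (fun p : Spt => ‖p.2‖) p = omm a p := by
  have hd := smooth_diffAt r_smooth hp
  have h1 := pd_mul hd hd a
  have h2 : (fun p : Spt => ‖p.2‖ * ‖p.2‖) = fun p : Spt => ∑ b : Fin 4, xs b p * xs b p := by
    funext p
    rw [← sq, EuclideanSpace.norm_sq_eq]
    simp [Fin.sum_univ_succ, xs]
    ring
  have hx : ∀ b, DifferentiableAt ℝ (xs b) p := fun b =>
    (xs_contDiff b).differentiable (by simp) p
  rw [h2, pd_sum _ (fun b _ => (hx b).fun_mul (hx b))] at h1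
  simp only [pd_mul (hx _) (hx _), pd_xs] at h1
  have h3 : ∑ b : Fin 4, (xs b p * cc b a + cc b a * xs b p) = 2 * xs a p := by
    fin_cases a <;> simp [Fin.sum_univ_succ, cc, xs] <;> ring_nf <;> rfl
  rw [h3] at h1
  have := r_pos hp
  rw [omm_eq]
  field_simp
  linarith

lemma rinv_smooth : ContDiffOn ℝ ∞ (fun p : Spt => ‖p.2‖⁻¹) UU :=
  r_smooth.inv fun _ hp => (r_pos hp).ne'

lemma pd_rinv (a : Fin 4) {p : Spt} (hp : p ∈ UU) :
    pd a (fun p : Spt => ‖p.2‖⁻¹) p = -1 * (omm a p * (‖p.2‖⁻¹ * ‖p.2‖⁻¹)) := by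
  have hr := r_pos hp
  rw [pd_comp (φ := fun x => x⁻¹) (differentiableAt_inv hr.ne') (smooth_diffAt r_smooth hp),
    pd_r a hp]
  simp
  field_simp

lemma omm_smooth (a : Fin 4) : ContDiffOn ℝ ∞ (omm a) UU :=
  ((xs_contDiff a).contDiffOn.mul rinv_smooth).congr fun p _ => omm_eq a p

lemma pd_omm (a b : Fin 4) {p : Spt} (hp : p ∈ UU) :
    pd b (omm a) p = (cc a b + -1 * (omm a p * omm b p)) * ‖p.2‖⁻¹ := by
  have h : omm a = fun p => xs a p * ‖p.2‖⁻¹ := funext (omm_eq a)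
  rw [h, pd_mul ((xs_contDiff a).differentiable (by simp) p) (smooth_diffAt rinv_smooth hp),
    pd_rinv b hp, pd_xs]
  ring

lemma omm_le (a : Fin 4) (p : Spt) : |omm a p| ≤ 1 := by
  refine Fin.cases ?_ (fun i => ?_) a
  · simp [omm]
  · have := PiLp.norm_apply_le p.2 i
    simp only [omm, Fin.cases_succ, abs_div, abs_norm]
    exact div_le_one_of_le₀ (by simpa using this) (norm_nonneg _)

lemma Sy_omm_rinv {M₀ : ℝ} (n : ℕ) : (∀ a, Sy M₀ n (fun _ _ => 1) (fun _ => omm a)) ∧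
    Sy M₀ n (fun _ p => ‖p.2‖⁻¹) (fun _ p => ‖p.2‖⁻¹) := by
  have key : (∀ a, Sy M₀ 0 (fun _ _ => 1) (fun _ => omm a)) ∧
    Sy M₀ 0 (fun _ p => ‖p.2‖⁻¹) (fun _ p => ‖p.2‖⁻¹) := by
    refine ⟨fun a => ⟨fun _ _ _ => omm_smooth a, 1, one_pos, fun _ _ _ p _ => ?_⟩,
      fun _ _ _ => rinv_smooth, 1, one_pos, fun _ _ _ p _ => ?_⟩
    · simpa using omm_le a p
    · simp
  induction n with
  | zero => exact key
  | succ n ih =>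
    refine ⟨fun a => ⟨key.1 a, fun b => ?_⟩, key.2, fun b => ?_⟩
    · refine (((Sy.const (cc a b)).add ((((ih.1 a).mul (ih.1 b)).cMul (-1)).mono' ?_)).mul
        ih.2).congr fun _ _ _ p hp => pd_omm a b hp
      intros; simp
    · refine ((((ih.1 b).mul (ih.2.mul ih.2)).cMul (-1)).mono' ?_).congr
        fun _ _ _ p hp => pd_rinv b hp
      intros; simp

lemma Sy_log {M₀ : ℝ} (n : ℕ) : Sy M₀ n (fun _ p => 1 + |Real.log ‖p.2‖|)
    (fun _ p => Real.log ‖p.2‖) := by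
  have hs : ContDiffOn ℝ ∞ (fun p : Spt => Real.log ‖p.2‖) UU :=
    r_smooth.log fun _ hp => (r_pos hp).ne'
  have key : Sy M₀ 0 (fun _ p => 1 + |Real.log ‖p.2‖|) (fun _ p => Real.log ‖p.2‖) :=
    ⟨fun _ _ _ => hs, 1, one_pos, fun _ _ _ p _ => by simp⟩
  cases n with
  | zero => exact key
  | succ n =>
    refine ⟨key, fun a => ((((Sy_omm_rinv n).1 a).mul (Sy_omm_rinv n).2).mono' ?_).congr ?_⟩
    · intro _ _ _ p hp
      have := r_pos hp
      gcongr
      simp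
    · intro _ _ _ p hp
      have hr := r_pos hp
      rw [pd_comp (Real.differentiableAt_log hr.ne') (smooth_diffAt r_smooth hp), pd_r a hp,
        Real.deriv_log]
      ring

def ss (p : Spt) : ℝ := ‖p.2‖ / (p.1 + 1)

lemma ss_pos {p : Spt} (hp : p ∈ UU) : 0 < ss p :=
  div_pos (r_pos hp) (by linarith [hp.1])

lemma t_smooth : ContDiffOn ℝ ∞ (fun p : Spt => (p.1 + 1)⁻¹) UU := by
  refine ContDiffOn.inv (by fun_prop) fun p hp => ?_
  have := hp.1
  exact (by linarith : (0:ℝ) < p.1 + 1).ne'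

lemma ss_smooth : ContDiffOn ℝ ∞ ss UU :=
  (r_smooth.mul t_smooth).congr fun p _ => div_eq_mul_inv _ _

def d0 (a : Fin 4) : ℝ := Fin.cases 1 (fun _ => 0) a

lemma pd_t (a : Fin 4) (p : Spt) : pd a (fun p : Spt => p.1) p = d0 a := by
  have h : (fun p : Spt => p.1) = fun p => ContinuousLinearMap.fst ℝ ℝ E3 p := rfl
  rw [h, pd, ContinuousLinearMap.fderiv]
  refine Fin.cases ?_ (fun i => ?_) a <;> simp [dir, d0]

lemma pd_ss (a : Fin 4) {p : Spt} (hp : p ∈ UU) :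
    pd a ss p = (omm a p * ss p + -d0 a * ss p ^ 2) * ‖p.2‖⁻¹ := by
  have h : ss = fun p => ‖p.2‖ * (p.1 + 1)⁻¹ := funext fun p => div_eq_mul_inv _ _
  have hr := r_pos hp
  have ht : 0 < p.1 + 1 := by linarith [hp.1]
  rw [h, pd_mul (smooth_diffAt r_smooth hp) (smooth_diffAt t_smooth hp), pd_r a hp,
    pd_comp (φ := fun x => (x + 1)⁻¹) (g := fun p : Spt => p.1) (by fun_prop (disch := exact ht.ne'))
    (by fun_prop), pd_t]
  have : deriv (fun x : ℝ => (x + 1)⁻¹) p.1 = - ((p.1 + 1)^2)⁻¹ := by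
    have := ((hasDerivAt_id' p.1).add_const 1).fun_inv ht.ne'
    rw [this.deriv]; field_simp
  rw [this]
  field_simp
  ring

/-- Cutoff type functions. -/
structure Cut (φ : ℝ → ℝ) : Prop where
  smooth : ContDiff ℝ ∞ φ
  zero : ∀ s ≤ (1:ℝ)/4, φ s = 0
  dzero : ∀ s, (3:ℝ)/4 ≤ s → deriv φ s = 0
  bdd : ∃ C : ℝ, 0 < C ∧ ∀ s, |φ s| ≤ C

lemma Cut.dzero' {φ : ℝ → ℝ} (h : Cut φ) : ∀ s ≤ (1:ℝ)/4, deriv φ s = 0 := by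
  intro s hs
  have h1 : HasDerivWithinAt φ (deriv φ s) (Set.Iic s) s :=
    ((h.smooth.differentiable (by simp)) s).hasDerivAt.hasDerivWithinAt
  have h2 : HasDerivWithinAt φ 0 (Set.Iic s) s :=
    (hasDerivWithinAt_const s _ 0).congr (fun x hx => h.zero x (le_trans hx hs)) (h.zero s hs)
  exact (uniqueDiffWithinAt_Iic s).eq_deriv _ h1 h2

lemma Cut.next {φ : ℝ → ℝ} (h : Cut φ) (k : ℕ) : Cut (fun s => s ^ k * deriv φ s) := by
  have hs : ContDiff ℝ ∞ (fun s => s ^ k * deriv φ s) := by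
    have : ContDiff ℝ ∞ (deriv φ) := ((contDiff_infty_iff_deriv).1 h.smooth).2
    exact (contDiff_id.pow k).mul this
  have hz : ∀ s, (3:ℝ)/4 ≤ s → s ^ k * deriv φ s = 0 := fun s hs => by simp [h.dzero s hs]
  refine ⟨hs, fun s hs => by simp [h.dzero' s hs], fun s hs' => ?_, ?_⟩
  · have h1 : HasDerivWithinAt (fun s => s ^ k * deriv φ s) (deriv (fun s => s ^ k * deriv φ s) s)
      (Set.Ici s) s := ((hs.differentiable (by simp)) s).hasDerivAt.hasDerivWithinAt
    have h2 : HasDerivWithinAt (fun s => s ^ k * deriv φ s) 0 (Set.Ici s) s :=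
      (hasDerivWithinAt_const s _ 0).congr (fun x hx => hz x (le_trans hs' hx)) (hz s hs')
    exact (uniqueDiffWithinAt_Ici s).eq_deriv _ h1 h2
  · obtain ⟨C, hC⟩ := (isCompact_Icc (a := (1:ℝ)/4) (b := 3/4)).exists_bound_of_continuousOn
      hs.continuous.continuousOn
    refine ⟨|C| + 1, by positivity, fun s => ?_⟩
    rcases le_total s (1/4) with h4 | h4
    · simp [h.dzero' s h4]; positivity
    rcases le_total ((3:ℝ)/4) s with h5 | h5
    · simp [h.dzero s h5]; positivity
    · have := hC s ⟨h4, h5⟩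
      rw [Real.norm_eq_abs] at this
      linarith [le_abs_self C]

def KK (p : Spt) : ℝ := if ss p ≤ 1/4 then 0 else 1

lemma KK_nonneg (p : Spt) : 0 ≤ KK p := by unfold KK; split_ifs <;> norm_num
lemma KK_le (p : Spt) : KK p ≤ 1 := by unfold KK; split_ifs <;> norm_num

lemma Sy_cut {M₀ : ℝ} (n : ℕ) : ∀ {φ : ℝ → ℝ}, Cut φ →
    Sy M₀ n (fun _ p => KK p) (fun _ p => φ (ss p)) := by
  have key : ∀ {φ : ℝ → ℝ}, Cut φ → Sy M₀ 0 (fun _ p => KK p) (fun _ p => φ (ss p)) := by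
    intro φ h
    obtain ⟨C, hC, hb⟩ := h.bdd
    refine ⟨fun _ _ _ => h.smooth.comp_contDiffOn ss_smooth, C, hC, fun _ _ _ p _ => ?_⟩
    show |φ (ss p)| ≤ C * KK p
    unfold KK
    split_ifs with h1
    · simp [h.zero _ h1]
    · simpa using hb _
  induction n with
  | zero => exact key
  | succ n ih =>
    intro φ h
    refine ⟨key h, fun a => ?_⟩
    have e1 := ((Sy_omm_rinv n (M₀ := M₀)).1 a).mul (ih (h.next 1))
    have e2 := (ih (h.next 2)).cMul (-d0 a)
    refine (((e1.mono' ?_).add e2).mul (Sy_omm_rinv n).2).congr fun _ _ _ p hp => ?_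
    · intros; simp
    · rw [pd_comp ((h.smooth.differentiable (by simp)) _) (smooth_diffAt ss_smooth hp), pd_ss a hp]
      ring

def gg (χ : ℝ → ℝ) (a : Fin 4) (p : Spt) : ℝ := omm a p * (χ (ss p) * Real.log ‖p.2‖)

def WW (M : ℝ) (p : Spt) : ℝ := M * (KK p * (1 + |Real.log ‖p.2‖|)) * ‖p.2‖⁻¹

def EE (χ : ℝ → ℝ) (a α : Fin 4) (M : ℝ) (p : Spt) : ℝ := Amat M χ p a α - kron a α

lemma Sy_gg {M₀ : ℝ} (n : ℕ) {χ : ℝ → ℝ} (h : Cut χ) (a : Fin 4) :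
    Sy M₀ n (fun M p => M * (KK p * (1 + |Real.log ‖p.2‖|))) (fun M p => M * gg χ a p) :=
  ((((Sy_omm_rinv n).1 a).mul ((Sy_cut n h).mul (Sy_log n))).mono' (by intros; simp)).mMul

lemma EE_eq {χ : ℝ → ℝ} (h : Cut χ) (a α : Fin 4) (M : ℝ) (hM : 0 < M) (p : Spt) (hp : p ∈ UU) :
    EE χ a α M p = pd α (fun p => M * gg χ a p) p := by
  have hg : DifferentiableAt ℝ (fun p => M * gg χ a p) p :=
    smooth_diffAt ((Sy_gg (M₀ := M) 0 h a).smooth M hM le_rfl) hp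
  show pd α (xt M χ a) p - kron a α = _
  induction a using Fin.cases with
  | zero =>
    have h1 : xt M χ 0 = fun p => p.1 := rfl
    have h2 : (fun p => M * gg χ 0 p) = fun _ => 0 := by
      funext p; simp [gg, omm]
    rw [h1, h2, pd_const, pd_t]
    refine Fin.cases ?_ (fun i => ?_) α
    · simp [d0, kron]
    · simp [d0, kron, (Fin.succ_ne_zero i).symm]
  | succ i =>
    have h1 : xt M χ i.succ = fun p => xs i.succ p + M * gg χ i.succ p := by
      funext p; simp [xt, xs, gg, omm, ss]; ring
    rw [h1, pd_add ((xs_contDiff _).differentiable (by simp) p) hg, pd_xs]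
    simp [cc, kron]

lemma Sy_EE {M₀ : ℝ} (n : ℕ) {χ : ℝ → ℝ} (h : Cut χ) (a α : Fin 4) :
    Sy M₀ n WW (EE χ a α) :=
  ((Sy_gg (n+1) h a).2 α).congr fun M hM _ p hp => EE_eq h a α M hM p hp

lemma WW_nonneg {M : ℝ} (hM : 0 < M) (p : Spt) : 0 ≤ WW M p := by
  have := KK_nonneg p
  unfold WW; positivity

lemma WW_le {M : ℝ} (hM : 0 < M) {p : Spt} (hp : p ∈ UU) : WW M p ≤ 73 * M := by
  unfold WW KK
  split_ifs with h
  · simp; exact hM.le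
  · have ht : 1/2 < p.1 + 1 := by linarith [hp.1]
    have hr := r_pos hp
    have h8 : 1/8 < ‖p.2‖ := by
      push Not at h
      rw [ss, lt_div_iff₀ (by linarith)] at h
      linarith
    have hl : |Real.log ‖p.2‖| ≤ ‖p.2‖ + ‖p.2‖⁻¹ := by
      have h1 := Real.log_le_self hr.le
      have h2 := Real.log_le_self (inv_nonneg.2 hr.le)
      rw [Real.log_inv] at h2
      have := inv_pos.2 hr
      rw [abs_le]; constructor <;> linarith
    have hi : ‖p.2‖⁻¹ ≤ 8 := by
      rw [inv_le_comm₀ hr (by norm_num)]; linarith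
    have hi0 := inv_pos.2 hr
    have : (1 + |Real.log ‖p.2‖|) * ‖p.2‖⁻¹ ≤ 73 := by
      calc _ ≤ (1 + (‖p.2‖ + ‖p.2‖⁻¹)) * ‖p.2‖⁻¹ := by gcongr
        _ = ‖p.2‖⁻¹ + 1 + ‖p.2‖⁻¹ * ‖p.2‖⁻¹ := by field_simp; ring
        _ ≤ 8 + 1 + 8 * 8 := by gcongr
        _ = 73 := by norm_num
    nlinarith

lemma EE_small {χ : ℝ → ℝ} (h : Cut χ) : ∃ M₀ : ℝ, 0 < M₀ ∧ ∀ M, 0 < M → M ≤ M₀ →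
    ∀ p ∈ UU, ∀ a α, |EE χ a α M p| ≤ 1/8 := by
  have h0 : ∀ a α, ∃ C : ℝ, 0 < C ∧ ∀ M, 0 < M → M ≤ 1 → ∀ p ∈ UU, |EE χ a α M p| ≤ C * WW M p :=
    fun a α => (Sy_EE (M₀ := 1) 0 h a α).2
  choose C hC hb using h0
  have hle : ∀ a α, C a α ≤ ∑ a, ∑ α, C a α := fun a α =>
    (Finset.single_le_sum (f := fun α => C a α) (fun i _ => (hC a i).le)
      (Finset.mem_univ α)).trans
    (Finset.single_le_sum (f := fun a => ∑ α, C a α)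
      (fun i _ => Finset.sum_nonneg fun j _ => (hC i j).le) (Finset.mem_univ a))
  set S := ∑ a, ∑ α, C a α
  have hS : 0 < S := (hC 0 0).trans_le (hle 0 0)
  refine ⟨min 1 (1 / (8 * 73 * S)), by positivity, fun M hM hM' p hp a α => ?_⟩
  have h1 := le_trans hM' (min_le_right _ _)
  rw [le_div_iff₀ (by positivity)] at h1
  calc _ ≤ C a α * WW M p := hb a α M hM (hM'.trans (min_le_left _ _)) p hp
    _ ≤ S * (73 * M) := mul_le_mul (hle a α) (WW_le hM hp) (WW_nonneg hM p) hS.le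
    _ ≤ 1/8 := by linarith

lemma Amat_eq (χ : ℝ → ℝ) (a α : Fin 4) (M : ℝ) (p : Spt) :
    Amat M χ p a α = kron a α + EE χ a α M p := by simp [EE]

lemma Amat_unit {χ : ℝ → ℝ} {M : ℝ} {p : Spt} (h : ∀ a α, |EE χ a α M p| ≤ 1/8) :
    IsUnit (Amat M χ p).det := by
  rw [isUnit_iff_ne_zero]
  refine det_ne_zero_of_sum_row_lt_diag fun k => ?_
  have h1 : ∑ j ∈ Finset.univ.erase k, ‖Amat M χ p k j‖ ≤ ∑ j ∈ Finset.univ.erase k, (1/8:ℝ) := by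
    refine Finset.sum_le_sum fun j hj => ?_
    rw [Amat_eq, kron, if_neg (Finset.ne_of_mem_erase hj).symm, zero_add]
    exact h k j
  have h2 : (7/8:ℝ) ≤ ‖Amat M χ p k k‖ := by
    rw [Amat_eq, kron, if_pos rfl, Real.norm_eq_abs]
    have := abs_le.1 (h k k)
    exact le_trans (by linarith) (le_abs_self _)
  refine h1.trans_lt (lt_of_lt_of_le ?_ h2)
  simp
  norm_num

lemma kron_one (a b : Fin 4) : kron a b = (1 : Matrix (Fin 4) (Fin 4) ℝ) a b := by
  simp [kron, Matrix.one_apply]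

lemma Ainv_eq {χ : ℝ → ℝ} {M : ℝ} {p : Spt} (h : IsUnit (Amat M χ p).det) (a b : Fin 4) :
    Ainv M χ p a b - kron a b = ∑ c, -1 * (EE χ a c M p * Ainv M χ p c b) := by
  have h1 := congrFun (congrFun (Matrix.mul_nonsing_inv _ h) a) b
  rw [Matrix.mul_apply, ← kron_one] at h1
  simp only [Amat_eq, add_mul, Finset.sum_add_distrib] at h1
  have : ∑ x, kron a x * (Amat M χ p)⁻¹ x b = (Amat M χ p)⁻¹ a b := by simp [kron]
  rw [this] at h1
  show (Amat M χ p)⁻¹ a b - kron a b = ∑ c, -1 * (EE χ a c M p * (Amat M χ p)⁻¹ c b)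
  simp only [neg_one_mul, Finset.sum_neg_distrib]
  linarith

lemma Ainv_le {χ : ℝ → ℝ} {M : ℝ} {p : Spt} (h : ∀ a α, |EE χ a α M p| ≤ 1/8) (a b : Fin 4) :
    |Ainv M χ p a b| ≤ 2 := by
  obtain ⟨c, hc⟩ := Finite.exists_max (fun c => |Ainv M χ p c b|)
  have h1 := Ainv_eq (Amat_unit h) c b
  have h2 : |Ainv M χ p c b - kron c b| ≤ ∑ d : Fin 4, 1/8 * |Ainv M χ p c b| := by
    rw [h1]
    refine (Finset.abs_sum_le_sum_abs _ _).trans (Finset.sum_le_sum fun d _ => ?_)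
    rw [neg_one_mul, abs_neg, abs_mul]
    exact mul_le_mul (h c d) (hc d) (abs_nonneg _) (by norm_num)
  simp at h2
  have h3 : |kron c b| ≤ 1 := by unfold kron; split_ifs <;> simp
  have h4 := abs_sub_abs_le_abs_sub (Ainv M χ p c b) (kron c b)
  have h5 : |Ainv M χ p a b| ≤ |Ainv M χ p c b| := hc a
  linarith

lemma det_smooth {A : Spt → Matrix (Fin 4) (Fin 4) ℝ}
    (h : ∀ a b, ContDiffOn ℝ ∞ (fun p => A p a b) UU) :
    ContDiffOn ℝ ∞ (fun p => (A p).det) UU := by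
  simp only [Matrix.det_apply]
  refine ContDiffOn.sum fun σ _ => ?_
  have : ContDiffOn ℝ ∞ (fun p => ∏ i, A p (σ i) i) UU := contDiffOn_prod fun i _ => h _ _
  exact this.const_smul _

lemma Ainv_smooth {χ : ℝ → ℝ} {M : ℝ} (hA : ∀ a b, ContDiffOn ℝ ∞ (fun p => Amat M χ p a b) UU)
    (h : ∀ p ∈ UU, IsUnit (Amat M χ p).det) (a b : Fin 4) :
    ContDiffOn ℝ ∞ (fun p => Ainv M χ p a b) UU := by
  have h1 : ContDiffOn ℝ ∞ (fun p => (Amat M χ p).adjugate a b) UU := by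
    simp only [Matrix.adjugate_apply]
    refine det_smooth fun c d => ?_
    simp only [Matrix.updateRow_apply]
    split_ifs
    · exact contDiffOn_const
    · exact hA _ _
  refine (((det_smooth hA).inv fun p hp => (h p hp).ne_zero).mul h1).congr fun p hp => ?_
  simp [Ainv, Matrix.inv_def]

lemma pd_Ainv {χ : ℝ → ℝ} {M : ℝ} (hA : ∀ a b, ContDiffOn ℝ ∞ (fun p => Amat M χ p a b) UU)
    (h : ∀ p ∈ UU, IsUnit (Amat M χ p).det) (e a b : Fin 4) {p : Spt} (hp : p ∈ UU) :
    pd e (fun p => Ainv M χ p a b) p =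
      ∑ c, ∑ d, -1 * (Ainv M χ p a c * (pd e (EE χ c d M) p * Ainv M χ p d b)) := by
  have hB := Ainv_smooth hA h
  have hE : ∀ c d, pd e (EE χ c d M) p = pd e (fun p => Amat M χ p c d) p := by
    intro c d
    have : (fun p => Amat M χ p c d) = fun p => EE χ c d M p + kron c d := by
      funext p; simp [EE]
    have hd : DifferentiableAt ℝ (EE χ c d M) p :=
      (smooth_diffAt (hA c d) hp).sub_const _
    rw [this, pd_add hd (differentiableAt_const _), pd_const, add_zero]
  set A' : Matrix (Fin 4) (Fin 4) ℝ := Matrix.of fun c d => pd e (fun p => Amat M χ p c d) p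
  set B' : Matrix (Fin 4) (Fin 4) ℝ := Matrix.of fun c d => pd e (fun p => Ainv M χ p c d) p
  have h1 : Amat M χ p * B' + A' * Ainv M χ p = 0 := by
    ext i j
    have h2 : ∀ q ∈ UU, (∑ c, Amat M χ q i c * Ainv M χ q c j) = kron i j := by
      intro q hq
      rw [← Matrix.mul_apply, Ainv, Matrix.mul_nonsing_inv _ (h q hq), kron_one]
    have h3 := pd_congr h2 e p hp
    rw [pd_const, pd_sum _ (fun c _ => (smooth_diffAt (hA i c) hp).fun_mul
      (smooth_diffAt (hB c j) hp))] at h3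
    simp only [pd_mul (smooth_diffAt (hA i _) hp) (smooth_diffAt (hB _ j) hp),
      Finset.sum_add_distrib] at h3
    simpa [Matrix.mul_apply, A', B'] using h3
  have h2 : B' = -(Ainv M χ p * (A' * Ainv M χ p)) := by
    have h3 : Ainv M χ p * (Amat M χ p * B') = B' := by
      rw [← Matrix.mul_assoc, Ainv, Matrix.nonsing_inv_mul _ (h p hp), Matrix.one_mul]
    rw [← h3, eq_neg_of_add_eq_zero_left h1, Matrix.mul_neg]
  have h3 := congrFun (congrFun h2 a) b
  simp only [hE]
  simpa [Matrix.mul_apply, A', B', Finset.mul_sum] using h3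

lemma Amat_smooth {χ : ℝ → ℝ} (hc : Cut χ) {M : ℝ} (hM : 0 < M) (a b : Fin 4) :
    ContDiffOn ℝ ∞ (fun p => Amat M χ p a b) UU := by
  have := (Sy_EE (M₀ := M) 0 hc a b).smooth M hM le_rfl
  refine (this.add (contDiffOn_const (c := kron a b))).congr fun p _ => ?_
  simp [EE]

lemma Sy_Ainv {χ : ℝ → ℝ} (hc : Cut χ) {M₀ : ℝ}
    (hs : ∀ M, 0 < M → M ≤ M₀ → ∀ p ∈ UU, ∀ a α, |EE χ a α M p| ≤ 1/8) (n : ℕ) :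
    ∀ a b, Sy M₀ n (fun _ _ => 1) (fun M p => Ainv M χ p a b) := by
  have key : ∀ a b, Sy M₀ 0 (fun _ _ => 1) (fun M p => Ainv M χ p a b) := by
    intro a b
    refine ⟨fun M hM hM' => Ainv_smooth (Amat_smooth hc hM)
      (fun p hp => Amat_unit (hs M hM hM' p hp)) a b, 2, two_pos, fun M hM hM' p hp => ?_⟩
    simpa using Ainv_le (hs M hM hM' p hp) a b
  induction n with
  | zero => exact key
  | succ n ih =>
    intro a b
    refine ⟨key a b, fun e => ?_⟩
    have hw : ∀ M, 0 < M → M ≤ M₀ → ∀ p ∈ UU, (0:ℝ) ≤ (fun (_ : ℝ) (p : Spt) => 1 * ‖p.2‖⁻¹) M p := by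
      intros; positivity
    refine Sy.congr (Sy.sum Finset.univ hw fun c => Sy.sum Finset.univ hw fun d => ?_)
      fun M hM hM' p hp => pd_Ainv (Amat_smooth hc hM)
        (fun p hp => Amat_unit (hs M hM hM' p hp)) e a b hp
    refine ((((ih a c).mul (((Sy_EE (n+1) hc c d).2 e).mul (ih d b))).cMul (-1))).mono
      (73 * (|M₀| + 1)) (by positivity) ?_
    intro M hM hM' p hp
    have h1 := WW_le hM hp
    have h2 := inv_pos.2 (r_pos hp)
    simp only [one_mul, mul_one]
    gcongr
    linarith [le_abs_self M₀]

lemma Sy_inv {χ : ℝ → ℝ} (hc : Cut χ) {M₀ : ℝ}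
    (hs : ∀ M, 0 < M → M ≤ M₀ → ∀ p ∈ UU, ∀ a α, |EE χ a α M p| ≤ 1/8) (n : ℕ) (a b : Fin 4) :
    Sy M₀ n WW (fun M p => Ainv M χ p a b - kron a b) := by
  refine Sy.congr (Sy.sum Finset.univ (fun M hM _ p _ => WW_nonneg hM p) fun c => ?_)
      fun M hM hM' p hp => Ainv_eq (Amat_unit (hs M hM hM' p hp)) a b
  exact (((Sy_EE n hc a c).mul (Sy_Ainv hc hs n c b)).cMul (-1)).mono' (by intros; simp)

/-- **Derivative bounds for the Jacobian of the asymptotically Schwarzschild coordinate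
change** (Proposition 5.2):  for `0 < M ≤ M₀`, `A` is invertible (for `t ≥ 0`, `x ≠ 0`), and
`|∂^β(A^a_α - δ^a_α)| + |∂^β(A^α_a - δ^α_a)| ≤ C_β M ⟨ln r⟩ r^{-1-|β|}`; moreover the
differences vanish identically where `r/(t+1) ≤ 1/4`. -/
theorem jacobian_derivative_bounds
    (χ : ℝ → ℝ) (hχ : ContDiff ℝ (⊤:ℕ∞) χ)
    (hχ0 : ∀ s ≤ (1:ℝ)/4, χ s = 0) (hχ1 : ∀ s, (3:ℝ)/4 ≤ s → χ s = 1)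
    (hχb : ∀ s, 0 ≤ χ s ∧ χ s ≤ 1) :
    ∃ M₀ : ℝ, 0 < M₀ ∧
    (∀ M : ℝ, 0 < M → M ≤ M₀ → ∀ p : Spt, 0 ≤ p.1 → p.2 ≠ 0 → IsUnit (Amat M χ p)) ∧
    (∀ (j : ℕ) (β : Fin j → Fin 4), ∃ C : ℝ, 0 < C ∧
      ∀ M : ℝ, 0 < M → M ≤ M₀ → ∀ p : Spt, 0 ≤ p.1 → p.2 ≠ 0 → ∀ a α : Fin 4,
        |pdT β (fun q => Amat M χ q a α - kron a α) p|
            + |pdT β (fun q => Ainv M χ q α a - kron α a) p|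
          ≤ C * M * (1 + |Real.log ‖p.2‖|) * ‖p.2‖ ^ (-(1:ℝ) - j)) ∧
    (∀ M : ℝ, 0 < M → M ≤ M₀ → ∀ p : Spt, 0 ≤ p.1 → p.2 ≠ 0 →
      ‖p.2‖ / (p.1 + 1) ≤ 1/4 → ∀ a α : Fin 4,
        Amat M χ p a α = kron a α ∧ Ainv M χ p α a = kron α a) := by
  have hc : Cut χ := by
    refine ⟨hχ, hχ0, fun s hs => ?_, 1, one_pos, fun s => ?_⟩
    · have h1 : HasDerivWithinAt χ (deriv χ s) (Set.Ici s) s :=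
        ((hχ.differentiable (by simp)) s).hasDerivAt.hasDerivWithinAt
      have h2 : HasDerivWithinAt χ 0 (Set.Ici s) s :=
        (hasDerivWithinAt_const s _ 1).congr (fun x hx => hχ1 x (le_trans hs hx)) (hχ1 s hs)
      exact (uniqueDiffWithinAt_Ici s).eq_deriv _ h1 h2
    · rw [abs_le]; constructor <;> linarith [(hχb s).1, (hχb s).2]
  obtain ⟨M₀, hM₀, hs⟩ := EE_small hc
  have hU : ∀ p : Spt, 0 ≤ p.1 → p.2 ≠ 0 → p ∈ UU := fun p h1 h2 => ⟨by linarith, h2⟩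
  refine ⟨M₀, hM₀, fun M hM hM' p hp hp' => ?_, fun j β => ?_, fun M hM hM' p hp hp' h4 a α => ?_⟩
  · exact (Matrix.isUnit_iff_isUnit_det _).2 (Amat_unit (hs M hM hM' p (hU p hp hp')))
  · have h1 := fun a α => (Sy_EE (M₀ := M₀) j hc a α).pdT_bound β
    have h2 := fun a α => (Sy_inv hc hs j α a).pdT_bound β
    choose C hC hb using h1
    choose D hD hd using h2
    have hle : ∀ a α, C a α + D a α ≤ ∑ a, ∑ α, (C a α + D a α) := fun a α =>
      (Finset.single_le_sum (f := fun α => C a α + D a α)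
        (fun i _ => (add_pos (hC a i) (hD a i)).le) (Finset.mem_univ α)).trans
      (Finset.single_le_sum (f := fun a => ∑ α, (C a α + D a α))
        (fun i _ => Finset.sum_nonneg fun j _ => (add_pos (hC i j) (hD i j)).le)
        (Finset.mem_univ a))
    refine ⟨∑ a, ∑ α, (C a α + D a α), (add_pos (hC 0 0) (hD 0 0)).trans_le (hle 0 0),
      fun M hM hM' p hp hp' a α => ?_⟩
    have hpU := hU p hp hp'
    have hr := r_pos hpU
    have e1 := hb a α M hM hM' p hpU
    have e2 := hd a α M hM hM' p hpU
    have hl := hle a α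
    have hpos : 0 < C a α + D a α := add_pos (hC a α) (hD a α)
    have hpow : ‖p.2‖ ^ (-(1:ℝ) - j) = ‖p.2‖⁻¹ * (‖p.2‖⁻¹) ^ j := by
      rw [Real.rpow_sub hr, Real.rpow_neg_one, Real.rpow_natCast, inv_pow, div_eq_mul_inv]
    have hW : WW M p * (‖p.2‖⁻¹) ^ j ≤ M * (1 + |Real.log ‖p.2‖|) * ‖p.2‖ ^ (-(1:ℝ) - j) := by
      rw [hpow, ← mul_assoc]
      unfold WW
      gcongr
      nlinarith [KK_le p, abs_nonneg (Real.log ‖p.2‖)]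
    have hW0 : 0 ≤ M * (1 + |Real.log ‖p.2‖|) * ‖p.2‖ ^ (-(1:ℝ) - j) := by positivity
    calc _ ≤ (C a α + D a α) * (WW M p * (‖p.2‖⁻¹) ^ j) := by
          rw [add_mul]; exact add_le_add e1 e2
      _ ≤ (C a α + D a α) * (M * (1 + |Real.log ‖p.2‖|) * ‖p.2‖ ^ (-(1:ℝ) - j)) := by gcongr
      _ ≤ (∑ a, ∑ α, (C a α + D a α)) * (M * (1 + |Real.log ‖p.2‖|) * ‖p.2‖ ^ (-(1:ℝ) - j)) := by
          gcongr
      _ = _ := by ring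
  · have hpU := hU p hp hp'
    have hW : WW M p = 0 := by
      have : KK p = 0 := if_pos h4
      simp [WW, this]
    obtain ⟨-, C, -, h1⟩ := Sy_EE (M₀ := M₀) 0 hc a α
    obtain ⟨-, D, -, h2⟩ := Sy_inv hc hs 0 α a
    have e1 := h1 M hM hM' p hpU
    have e2 := h2 M hM hM' p hpU
    rw [hW, mul_zero] at e1 e2
    exact ⟨sub_eq_zero.1 (abs_nonpos_iff.1 e1), sub_eq_zero.1 (abs_nonpos_iff.1 e2)⟩
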